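/- The value of the Riemann zeta function at 3 satisfies ζ(3) = -8π² · ( (5/12)·ln 3 - (13/24)·ln 2 - 3/32 - SC - SD ), where SC = (1/16) ∑_{l=1}^∞ (ζ(2l) - 1)/((l+1)·4^l) and SD = -(1/24) ∑_{l=1}^∞ (ζ(2l) - 1)/((2l+3)·4^l). -/

import Mathlib

open Real

/-- `SC = (1/16) ∑_{l=1}^∞ (ζ(2l) - 1)/((l+1)·4^l)`. -/
noncomputable def SC : ℂ :=
  1 / 16 * ∑' l : ℕ+, (riemannZeta (2 * (l : ℕ)) - 1) / (((l : ℕ) + 1) * 4 ^ (l : ℕ))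

/-- `SD = -(1/24) ∑_{l=1}^∞ (ζ(2l) - 1)/((2l+3)·4^l)`. -/
noncomputable def SD : ℂ :=
  -(1 / 24) * ∑' l : ℕ+, (riemannZeta (2 * (l : ℕ)) - 1) / ((2 * (l : ℕ) + 3) * 4 ^ (l : ℕ))

open Filter Topology MeasureTheory
open scoped FourierTransform

theorem two_mul_sin_mul_sum_sin (x : ℝ) (N : ℕ) :
    2 * sin (π * x) * ∑ n ∈ Finset.range N, sin (2 * π * (n + 1) * x) =
      cos (π * x) - cos ((2 * N + 1) * (π * x)) := by
  induction N with
  | zero => simp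
  | succ N ih =>
    rw [Finset.sum_range_succ, mul_add, ih]
    have h1 : (2 * (N : ℝ) + 1) * (π * x) = 2 * π * (N + 1) * x - π * x := by ring
    have h2 : (2 * ((N + 1 : ℕ) : ℝ) + 1) * (π * x) = 2 * π * (N + 1) * x + π * x := by
      push_cast; ring
    rw [h1, h2, cos_sub, cos_add]
    ring

theorem integral_mul_sin (n : ℕ) :
    ∫ x in (0 : ℝ)..(1 / 2), π * (x ^ 2 - 2 / 3 * x ^ 3) * sin (2 * π * (n + 1) * x) =
      -(-1) ^ (n + 1) / (12 * (n + 1)) - 1 / (4 * π ^ 2 * (n + 1) ^ 3) := by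
  have hn : (n : ℝ) + 1 ≠ 0 := by positivity
  have hw : 2 * π * ((n : ℝ) + 1) ≠ 0 := by positivity
  have hc : cos (2 * π * ((n : ℝ) + 1) * (1 / 2)) = (-1) ^ (n + 1) := by
    have := Real.cos_nat_mul_pi (n + 1)
    rw [← this]; congr 1; push_cast; ring
  have hs : sin (2 * π * ((n : ℝ) + 1) * (1 / 2)) = 0 := by
    have := Real.sin_nat_mul_pi (n + 1)
    rw [← this]; congr 1; push_cast; ring
  set w := 2 * π * ((n : ℝ) + 1) with hwdef
  have key : ∀ x ∈ Set.uIcc (0 : ℝ) (1 / 2), HasDerivAt (fun x : ℝ =>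
      π * ((-x ^ 2 * cos (w * x) / w + 2 * x * sin (w * x) / w ^ 2 + 2 * cos (w * x) / w ^ 3) -
        2 / 3 * (-x ^ 3 * cos (w * x) / w + 3 * x ^ 2 * sin (w * x) / w ^ 2 +
          6 * x * cos (w * x) / w ^ 3 - 6 * sin (w * x) / w ^ 4)))
      (π * (x ^ 2 - 2 / 3 * x ^ 3) * sin (w * x)) x := by
    intro x _
    have hwx : HasDerivAt (fun x : ℝ => w * x) w x := by
      simpa using (hasDerivAt_id x).const_mul w
    have hC := hwx.cos
    have hS := hwx.sin
    have h1 := hasDerivAt_id' x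
    have h2 := hasDerivAt_pow 2 x
    have h3 := hasDerivAt_pow 3 x
    have := (((((h2.neg.mul hC).div_const w).add (((h1.const_mul 2).mul hS).div_const (w ^ 2))).add
      ((hC.const_mul 2).div_const (w ^ 3))).sub
      ((((((h3.neg.mul hC).div_const w).add (((h2.const_mul 3).mul hS).div_const (w ^ 2))).add
      (((h1.const_mul 6).mul hC).div_const (w ^ 3))).sub
        ((hS.const_mul 6).div_const (w ^ 4))).const_mul (2 / 3))).const_mul π
    refine this.congr_deriv ?_
    simp only [Pi.neg_apply]
    field_simp
    push_cast
    ring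
  rw [intervalIntegral.integral_eq_sub_of_hasDerivAt key
    (by apply Continuous.intervalIntegrable; fun_prop)]
  simp only [hc, hs, mul_zero, cos_zero, sin_zero]
  rw [hwdef]
  field_simp
  ring

theorem tendsto_sum_alternating :
    Tendsto (fun N : ℕ => ∑ n ∈ Finset.range (2 * N), -(-1 : ℝ) ^ (n + 1) / (n + 1)) atTop
      (𝓝 (Real.log 2)) := by
  have h (N : ℕ) : ∑ n ∈ Finset.range (2 * N), -(-1 : ℝ) ^ (n + 1) / (n + 1) =
      harmonic (2 * N) - harmonic N := by
    induction N with
    | zero => simp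
    | succ N ih =>
      rw [show 2 * (N + 1) = 2 * N + 1 + 1 by ring, Finset.sum_range_succ, Finset.sum_range_succ, ih,
        harmonic_succ, harmonic_succ, harmonic_succ]
      push_cast
      have : (-1 : ℝ) ^ (2 * N) = 1 := by simp
      simp only [pow_succ _ (2 * N), pow_succ _ (2 * N + 1), this]
      field_simp
      ring
  have h2 : Tendsto (fun N : ℕ => 2 * N) atTop atTop :=
    tendsto_id.const_mul_atTop' (by norm_num)
  have := ((Real.tendsto_harmonic_sub_log.comp h2).sub Real.tendsto_harmonic_sub_log).add_const
    (Real.log 2)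
  rw [sub_self, zero_add] at this
  refine this.congr' ?_
  filter_upwards [eventually_gt_atTop 0] with N hN
  rw [h]
  simp only [Function.comp]
  push_cast
  rw [Real.log_mul (by norm_num) (by positivity)]
  ring

theorem tendsto_integral_mul_cos {f : ℝ → ℝ}
    (hf : IntervalIntegrable f volume 0 (1 / 2)) :
    Tendsto (fun N : ℕ => ∫ x in (0 : ℝ)..(1 / 2), f x * cos ((2 * N + 1) * (π * x))) atTop
      (𝓝 0) := by
  have hf' := (intervalIntegrable_iff_integrableOn_Ioc_of_le (by norm_num)).1 hf
  have := Real.tendsto_integral_exp_smul_cocompact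
    ((Set.Ioc (0 : ℝ) (1 / 2)).indicator fun x => ((f x : ℝ) : ℂ))
  have hw : Tendsto (fun N : ℕ => (N : ℝ) + 1 / 2) atTop (cocompact ℝ) :=
    (tendsto_atTop_add_const_right _ _ tendsto_natCast_atTop_atTop).mono_right
      atTop_le_cocompact
  have h := (Complex.continuous_re.tendsto _).comp (this.comp hw)
  rw [Complex.zero_re] at h
  refine h.congr fun N => ?_
  simp only [Function.comp]
  have e : (fun v : ℝ => 𝐞 (-(v * ((N : ℝ) + 1 / 2))) •
      (Set.Ioc (0 : ℝ) (1 / 2)).indicator (fun x => ((f x : ℝ) : ℂ)) v) =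
      (Set.Ioc (0 : ℝ) (1 / 2)).indicator
        (fun v => 𝐞 (-(v * ((N : ℝ) + 1 / 2))) • ((f v : ℝ) : ℂ)) := by
    ext v
    by_cases hv : v ∈ Set.Ioc (0 : ℝ) (1 / 2)
    · rw [Set.indicator_of_mem hv, Set.indicator_of_mem hv]
    · rw [Set.indicator_of_notMem hv, Set.indicator_of_notMem hv, smul_zero]
  rw [e, integral_indicator measurableSet_Ioc,
    intervalIntegral.integral_of_le (by norm_num)]
  have hint : IntegrableOn
      (fun v : ℝ => 𝐞 (-(v * ((N : ℝ) + 1 / 2))) • ((f v : ℝ) : ℂ)) (Set.Ioc (0 : ℝ) (1 / 2)) := by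
    have hfc : Integrable (fun v => ((f v : ℝ) : ℂ)) (volume.restrict (Set.Ioc 0 (1 / 2))) :=
      hf'.ofReal
    refine hfc.mono (AEStronglyMeasurable.smul (Continuous.aestronglyMeasurable (by fun_prop))
      hfc.aestronglyMeasurable) (Eventually.of_forall fun v => ?_)
    rw [Circle.norm_smul]
  have := integral_re hint
  simp only [RCLike.re_eq_complex_re] at this
  rw [← this]
  refine setIntegral_congr_fun measurableSet_Ioc fun v _ => ?_
  simp only [Circle.smul_def, Real.fourierChar_apply, smul_eq_mul, Complex.re_mul_ofReal,
    Complex.exp_ofReal_mul_I_re]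
  rw [mul_comm, ← cos_neg]
  congr 2
  ring

/-- The Dirichlet series `∑ 1 / n ^ k` over positive integers, as a real number. -/
noncomputable def zetaReal (k : ℕ) : ℝ := ∑' n : ℕ, 1 / ((n : ℝ) + 1) ^ k

theorem hasSum_zetaReal {k : ℕ} (hk : 1 < k) :
    HasSum (fun n : ℕ => 1 / ((n : ℝ) + 1) ^ k) (zetaReal k) := by
  refine Summable.hasSum ?_
  have := (summable_nat_add_iff 1).2 (Real.summable_one_div_nat_pow.2 hk)
  simpa using this

theorem riemannZeta_natCast_eq_zetaReal {k : ℕ} (hk : 1 < k) :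
    riemannZeta k = (zetaReal k : ℂ) := by
  rw [zeta_nat_eq_tsum_of_gt_one hk]
  have h := (Real.summable_one_div_nat_pow.2 hk)
  have e : ∑' n : ℕ, 1 / (n : ℝ) ^ k = zetaReal k := by
    rw [h.tsum_eq_zero_add, zetaReal]
    simp [show k ≠ 0 by omega]
  rw [← e, Complex.ofReal_tsum]
  push_cast
  rfl

theorem one_le_zetaReal {k : ℕ} (hk : 1 < k) : 1 ≤ zetaReal k := by
  have := (hasSum_zetaReal hk).summable.le_tsum 0 (fun n _ => by positivity)
  simpa [zetaReal] using this

theorem zetaReal_le_zetaReal_two {k : ℕ} (hk : 1 < k) : zetaReal k ≤ zetaReal 2 := by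
  refine hasSum_le (fun n => ?_) (hasSum_zetaReal hk) (hasSum_zetaReal one_lt_two)
  have : (1 : ℝ) ≤ n + 1 := by linarith [n.cast_nonneg (α := ℝ)]
  exact one_div_le_one_div_of_le (by positivity) (pow_le_pow_right₀ this hk)

theorem sinc_pi_mul_pos {x : ℝ} (h0 : 0 ≤ x) (h1 : x ≤ 1 / 2) : 0 < sinc (π * x) := by
  rcases h0.eq_or_lt with rfl | h0
  · simp
  · have : 0 < π * x := by positivity
    rw [sinc_of_ne_zero this.ne']
    refine div_pos (sin_pos_of_pos_of_lt_pi this ?_) this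
    nlinarith [pi_pos]

theorem hasSum_cot_partial_fractions {x : ℝ} (h0 : 0 < x) (h1 : x ≤ 1 / 2) :
    HasSum (fun n : ℕ => x ^ 2 / ((n + 1) ^ 2 - x ^ 2)) ((1 - cos (π * x) / sinc (π * x)) / 2) := by
  have hx : (x : ℂ) ∈ Complex.integerComplement := by
    rintro ⟨n, hn⟩
    have hn' : (n : ℝ) = x := by exact_mod_cast hn
    have a1 : (0 : ℝ) < n := by linarith
    have a2 : (n : ℝ) < 1 := by linarith
    norm_cast at a1 a2
    omega
  have hS := (summable_cotTerm hx).hasSum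
  have hs0 := sinc_pi_mul_pos h0.le h1
  have hpx : π * x ≠ 0 := by positivity
  have hs : sin (π * x) ≠ 0 := by
    rw [sinc_of_ne_zero hpx] at hs0
    intro h
    simp [h] at hs0
  have hS' := hS.mul_left (-(x : ℂ) / 2)
  simp only [cotTerm] at hS'
  rw [← cot_series_rep' hx] at hS'
  have hval : -(x : ℂ) / 2 * (π * Complex.cot (π * x) - 1 / x) =
      (((1 - cos (π * x) / sinc (π * x)) / 2 : ℝ) : ℂ) := by
    have : -x / 2 * (π * (cos (π * x) / sin (π * x)) - 1 / x) =
        (1 - cos (π * x) / sinc (π * x)) / 2 := by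
      rw [sinc_of_ne_zero hpx]
      field_simp
      ring
    rw [← this, Complex.cot]
    push_cast
    rfl
  rw [hval] at hS'
  refine Complex.hasSum_ofReal.1 (hS'.congr_fun fun n => Eq.symm ?_)
  have hn : (0 : ℝ) ≤ n := n.cast_nonneg
  have e1 : x - ((n : ℝ) + 1) ≠ 0 := by linarith
  have e2 : x + ((n : ℝ) + 1) ≠ 0 := by positivity
  have e3 : ((n : ℝ) + 1) ^ 2 - x ^ 2 ≠ 0 := by
    rw [show ((n : ℝ) + 1) ^ 2 - x ^ 2 = -((x - (n + 1)) * (x + (n + 1))) by ring]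
    exact neg_ne_zero.2 (mul_ne_zero e1 e2)
  have : -x / 2 * (1 / (x - (n + 1)) + 1 / (x + (n + 1))) = x ^ 2 / ((n + 1) ^ 2 - x ^ 2) := by
    field_simp
    ring
  rw [← this]
  push_cast
  rfl

theorem hasSum_zetaReal_mul_pow {x : ℝ} (h0 : 0 ≤ x) (h1 : x ≤ 1 / 2) :
    HasSum (fun l : ℕ => zetaReal (2 * (l + 1)) * x ^ (2 * (l + 1)))
      ((1 - cos (π * x) / sinc (π * x)) / 2) := by
  rcases h0.eq_or_lt with rfl | h0
  · simp [hasSum_zero]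
  have hr (n : ℕ) : x ^ 2 / ((n : ℝ) + 1) ^ 2 < 1 := by
    rw [div_lt_one (by positivity)]
    have : (0 : ℝ) ≤ n := n.cast_nonneg
    nlinarith
  have hinner (n : ℕ) : HasSum (fun l : ℕ => (x ^ 2 / ((n : ℝ) + 1) ^ 2) ^ (l + 1))
      (x ^ 2 / ((n + 1) ^ 2 - x ^ 2)) := by
    have := (hasSum_geometric_of_lt_one (by positivity) (hr n)).mul_left
      (x ^ 2 / ((n : ℝ) + 1) ^ 2)
    simp only [← pow_succ'] at this
    have h2 := sub_pos.2 (hr n)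
    have h3 : (0 : ℝ) < (n + 1) ^ 2 - x ^ 2 := by
      have : (0 : ℝ) ≤ n := n.cast_nonneg
      nlinarith
    have e : x ^ 2 / ((n : ℝ) + 1) ^ 2 * (1 - x ^ 2 / ((n : ℝ) + 1) ^ 2)⁻¹ =
        x ^ 2 / ((n + 1) ^ 2 - x ^ 2) := by
      field_simp
    rwa [e] at this
  have houter := hasSum_cot_partial_fractions h0 h1
  have hsum : Summable fun q : ℕ × ℕ => (x ^ 2 / ((q.1 : ℝ) + 1) ^ 2) ^ (q.2 + 1) := by
    refine (summable_prod_of_nonneg fun q => by positivity).2 ⟨fun n => (hinner n).summable, ?_⟩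
    refine houter.summable.congr fun n => ?_
    exact (hinner n).tsum_eq.symm
  have htot := hsum.hasSum
  rw [(htot.prod_fiberwise hinner).unique houter] at htot
  have hswap := (Equiv.prodComm ℕ ℕ).hasSum_iff.2 htot
  refine hswap.prod_fiberwise fun l => ?_
  refine ((hasSum_zetaReal (k := 2 * (l + 1)) (by omega)).mul_right (x ^ (2 * (l + 1)))).congr_fun
    fun n => Eq.symm ?_
  simp only [Function.comp, Equiv.prodComm_apply, Prod.swap]
  rw [div_pow, ← pow_mul, ← pow_mul]
  ring

theorem hasSum_zetaReal_sub_one_mul_pow {x : ℝ} (h0 : 0 ≤ x) (h1 : x ≤ 1 / 2) :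
    HasSum (fun l : ℕ => (zetaReal (2 * (l + 1)) - 1) * x ^ (2 * (l + 1)))
      ((1 - cos (π * x) / sinc (π * x)) / 2 - x ^ 2 / (1 - x ^ 2)) := by
  have hx : x ^ 2 < 1 := by nlinarith
  have hg := (hasSum_geometric_of_lt_one (by positivity) hx).mul_left (x ^ 2)
  rw [← div_eq_mul_inv] at hg
  refine ((hasSum_zetaReal_mul_pow h0 h1).sub hg).congr_fun fun l => Eq.symm ?_
  rw [← pow_succ', ← pow_mul]
  ring

theorem hasSum_integral_zetaReal :
    HasSum (fun l : ℕ => ∫ x in (0 : ℝ)..(1 / 2),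
        (x / 2 - x ^ 2 / 3) * ((zetaReal (2 * (l + 1)) - 1) * x ^ (2 * (l + 1))))
      (∫ x in (0 : ℝ)..(1 / 2),
        (x / 2 - x ^ 2 / 3) * ((1 - cos (π * x) / sinc (π * x)) / 2 - x ^ 2 / (1 - x ^ 2))) := by
  have hIcc {x : ℝ} (hx : x ∈ Set.uIoc (0 : ℝ) (1 / 2)) : 0 ≤ x ∧ x ≤ 1 / 2 := by
    rw [Set.uIoc_of_le (by norm_num)] at hx
    exact ⟨hx.1.le, hx.2⟩
  refine intervalIntegral.hasSum_integral_of_dominated_convergence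
    (fun l _ => zetaReal 2 * (1 / 4) ^ (l + 1)) (fun l => ?_) (fun l => ?_) ?_ ?_ ?_
  · exact Continuous.aestronglyMeasurable (by fun_prop)
  · refine Eventually.of_forall fun x hx => ?_
    obtain ⟨h0, h1⟩ := hIcc hx
    have hz1 := one_le_zetaReal (k := 2 * (l + 1)) (by omega)
    have hz2 := zetaReal_le_zetaReal_two (k := 2 * (l + 1)) (by omega)
    have hp0 : 0 ≤ x / 2 - x ^ 2 / 3 := by nlinarith
    have hp1 : x / 2 - x ^ 2 / 3 ≤ 1 := by nlinarith
    have hx2 : x ^ (2 * (l + 1)) ≤ (1 / 4) ^ (l + 1) := by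
      rw [pow_mul]
      gcongr
      nlinarith
    rw [Real.norm_of_nonneg (mul_nonneg hp0 (mul_nonneg (by linarith) (by positivity)))]
    calc _ ≤ 1 * ((zetaReal (2 * (l + 1)) - 1) * x ^ (2 * (l + 1))) := by
          exact mul_le_mul_of_nonneg_right hp1 (mul_nonneg (by linarith) (by positivity))
      _ ≤ _ := by
          rw [one_mul]
          exact mul_le_mul (by linarith) hx2 (by positivity) (by linarith)
  · refine Eventually.of_forall fun x _ => ?_
    exact ((summable_nat_add_iff 1).2
      (summable_geometric_of_lt_one (by norm_num) (by norm_num))).mul_left _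
  · exact intervalIntegrable_const
  · refine Eventually.of_forall fun x hx => ?_
    obtain ⟨h0, h1⟩ := hIcc hx
    exact (hasSum_zetaReal_sub_one_mul_pow h0 h1).mul_left _

theorem integral_zetaReal_term (l : ℕ) (a : ℝ) :
    ∫ x in (0 : ℝ)..(1 / 2), (x / 2 - x ^ 2 / 3) * (a * x ^ (2 * (l + 1))) =
      1 / 16 * (a / (((l + 1 : ℕ) + 1) * 4 ^ (l + 1))) +
        -(1 / 24) * (a / ((2 * (l + 1 : ℕ) + 3) * 4 ^ (l + 1))) := by
  have e (x : ℝ) : (x / 2 - x ^ 2 / 3) * (a * x ^ (2 * (l + 1))) =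
      a / 2 * x ^ (2 * l + 3) - a / 3 * x ^ (2 * l + 4) := by ring
  simp only [e]
  rw [intervalIntegral.integral_sub (by apply Continuous.intervalIntegrable; fun_prop)
    (by apply Continuous.intervalIntegrable; fun_prop), intervalIntegral.integral_const_mul,
    intervalIntegral.integral_const_mul, integral_pow, integral_pow]
  have h4 : (4 : ℝ) ^ l = 2 ^ (2 * l) := by rw [pow_mul]; norm_num
  simp only [pow_succ, h4, one_div, inv_pow]
  push_cast
  field_simp
  ring

theorem integral_rational_part :
    ∫ x in (0 : ℝ)..(1 / 2), (x / 2 - x ^ 2 / 3) * (1 / 2 - x ^ 2 / (1 - x ^ 2)) =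
      5 / 12 * Real.log 3 - 1 / 2 * Real.log 2 - 3 / 32 := by
  have hx' {x : ℝ} (hx : x ∈ Set.uIcc (0 : ℝ) (1 / 2)) :
      1 - x ≠ 0 ∧ 1 + x ≠ 0 ∧ 1 - x ^ 2 ≠ 0 := by
    rw [Set.uIcc_of_le (by norm_num)] at hx
    obtain ⟨h0, h1⟩ := hx
    exact ⟨by linarith, by linarith, by nlinarith⟩
  have key : ∀ x ∈ Set.uIcc (0 : ℝ) (1 / 2), HasDerivAt (fun x : ℝ =>
      3 / 2 * (x ^ 2 / 4 - x ^ 3 / 9) + 1 / 4 * (Real.log (1 + x) + Real.log (1 - x)) - 1 / 3 * x +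
        1 / 6 * (Real.log (1 + x) - Real.log (1 - x)))
      ((x / 2 - x ^ 2 / 3) * (1 / 2 - x ^ 2 / (1 - x ^ 2))) x := by
    intro x hx
    obtain ⟨hm, hp, hq⟩ := hx' hx
    have h1 := hasDerivAt_id' x
    have h2 := hasDerivAt_pow 2 x
    have h3 := hasDerivAt_pow 3 x
    have hP := (h1.const_add 1).log hp
    have hM := (h1.const_sub 1).log hm
    have := (((((h2.div_const 4).sub (h3.div_const 9)).const_mul (3 / 2)).add
      ((hP.add hM).const_mul (1 / 4))).sub (h1.const_mul (1 / 3))).add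
      ((hP.sub hM).const_mul (1 / 6))
    refine this.congr_deriv ?_
    have hf : 1 - x ^ 2 = (1 - x) * (1 + x) := by ring
    rw [hf]
    field_simp
    ring
  rw [intervalIntegral.integral_eq_sub_of_hasDerivAt key]
  · have e1 : (1 : ℝ) + 1 / 2 = 3 / 2 := by norm_num
    have e2 : (1 : ℝ) - 1 / 2 = 1 / 2 := by norm_num
    rw [e1, e2, Real.log_div (by norm_num) (by norm_num), Real.log_div (by norm_num) (by norm_num)]
    simp
    ring
  · refine ContinuousOn.intervalIntegrable ?_
    refine ContinuousOn.mul (by fun_prop) (continuousOn_const.sub (ContinuousOn.div (by fun_prop)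
      (by fun_prop) fun x hx => (hx' hx).2.2))

theorem integral_mul_cos_div_sinc :
    ∫ x in (0 : ℝ)..(1 / 2), (x / 2 - x ^ 2 / 3) * (cos (π * x) / sinc (π * x)) =
      Real.log 2 / 12 - zetaReal 3 / (4 * π ^ 2) := by
  have hpos {x : ℝ} (hx : x ∈ Set.uIcc (0 : ℝ) (1 / 2)) : 0 < sinc (π * x) := by
    rw [Set.uIcc_of_le (by norm_num)] at hx
    exact sinc_pi_mul_pos hx.1 hx.2
  have hcont : ContinuousOn (fun x : ℝ => (x / 2 - x ^ 2 / 3) / sinc (π * x))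
      (Set.uIcc 0 (1 / 2)) :=
    ContinuousOn.div (by fun_prop) (continuous_sinc.comp (by fun_prop)).continuousOn
      fun x hx => (hpos hx).ne'
  have hsum (N : ℕ) : ∑ n ∈ Finset.range N,
      (-(-1) ^ (n + 1) / (12 * ((n : ℝ) + 1)) - 1 / (4 * π ^ 2 * (n + 1) ^ 3)) =
      (∫ x in (0 : ℝ)..(1 / 2), (x / 2 - x ^ 2 / 3) * (cos (π * x) / sinc (π * x))) -
      ∫ x in (0 : ℝ)..(1 / 2),
        (x / 2 - x ^ 2 / 3) / sinc (π * x) * cos ((2 * N + 1) * (π * x)) := by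
    simp only [← integral_mul_sin]
    rw [← intervalIntegral.integral_finsetSum fun n _ => by
        apply Continuous.intervalIntegrable; fun_prop,
      ← intervalIntegral.integral_sub]
    · refine intervalIntegral.integral_congr fun x hx => ?_
      have hs := hpos hx
      have hsin : sin (π * x) = π * x * sinc (π * x) := by
        rcases eq_or_ne x 0 with rfl | h0
        · simp
        · have : π * x ≠ 0 := mul_ne_zero pi_ne_zero h0
          rw [sinc_of_ne_zero this]
          field_simp
      have h := two_mul_sin_mul_sum_sin x N
      rw [hsin] at h
      simp only [← Finset.mul_sum]
      generalize ∑ n ∈ Finset.range N, sin (2 * π * (n + 1) * x) = S at h ⊢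
      generalize cos ((2 * N + 1) * (π * x)) = C at h ⊢
      field_simp
      linear_combination (x * (3 - 2 * x)) * h
    · refine (hcont.mul (by fun_prop : ContinuousOn (fun x : ℝ => cos (π * x)) _)).congr
        (fun x _ => ?_) |>.intervalIntegrable
      simp only [Pi.mul_apply]
      ring
    · exact (hcont.mul (by fun_prop)).intervalIntegrable
  have h2 : Tendsto (fun N : ℕ => 2 * N) atTop atTop :=
    tendsto_id.const_mul_atTop' (by norm_num)
  have hR := ((tendsto_integral_mul_cos hcont.intervalIntegrable).comp h2).const_sub
    (∫ x in (0 : ℝ)..(1 / 2), (x / 2 - x ^ 2 / 3) * (cos (π * x) / sinc (π * x)))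
  rw [sub_zero] at hR
  have hL := (tendsto_sum_alternating.div_const 12).sub
    ((((hasSum_zetaReal (k := 3) (by norm_num)).tendsto_sum_nat).comp h2).div_const (4 * π ^ 2))
  refine tendsto_nhds_unique hR (hL.congr fun N => ?_)
  simp only [Function.comp]
  rw [← hsum, Finset.sum_sub_distrib, Finset.sum_div, Finset.sum_div]
  congr 1 <;> refine Finset.sum_congr rfl fun n _ => ?_
  · rw [div_div, mul_comm]
  · rw [div_div, mul_comm]

theorem integral_zetaReal_sum :
    ∫ x in (0 : ℝ)..(1 / 2),
        (x / 2 - x ^ 2 / 3) * ((1 - cos (π * x) / sinc (π * x)) / 2 - x ^ 2 / (1 - x ^ 2)) =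
      5 / 12 * Real.log 3 - 13 / 24 * Real.log 2 - 3 / 32 + zetaReal 3 / (8 * π ^ 2) := by
  have hIcc {x : ℝ} (hx : x ∈ Set.uIcc (0 : ℝ) (1 / 2)) : 0 ≤ x ∧ x ≤ 1 / 2 := by
    rwa [Set.uIcc_of_le (by norm_num)] at hx
  have e (x : ℝ) :
      (x / 2 - x ^ 2 / 3) * ((1 - cos (π * x) / sinc (π * x)) / 2 - x ^ 2 / (1 - x ^ 2)) =
      (x / 2 - x ^ 2 / 3) * (1 / 2 - x ^ 2 / (1 - x ^ 2)) -
        1 / 2 * ((x / 2 - x ^ 2 / 3) * (cos (π * x) / sinc (π * x))) := by ring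
  simp only [e]
  rw [intervalIntegral.integral_sub, integral_rational_part, intervalIntegral.integral_const_mul,
    integral_mul_cos_div_sinc]
  · ring
  · refine ContinuousOn.intervalIntegrable (ContinuousOn.mul (by fun_prop)
      (continuousOn_const.sub (ContinuousOn.div (by fun_prop) (by fun_prop) fun x hx => ?_)))
    obtain ⟨h0, h1⟩ := hIcc hx
    nlinarith
  · refine ContinuousOn.intervalIntegrable (continuousOn_const.mul (ContinuousOn.mul (by fun_prop)
      (ContinuousOn.div (by fun_prop) (continuous_sinc.comp (by fun_prop)).continuousOn
        fun x hx => ?_)))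
    obtain ⟨h0, h1⟩ := hIcc hx
    exact (sinc_pi_mul_pos h0 h1).ne'

theorem summable_zetaReal_sub_one_div {d : ℕ → ℝ} (hd : ∀ l, 1 ≤ d l) :
    Summable fun l : ℕ => (zetaReal (2 * (l + 1)) - 1) / (d l * 4 ^ (l + 1)) := by
  have hz1 (l : ℕ) := one_le_zetaReal (k := 2 * (l + 1)) (by omega)
  have hz2 (l : ℕ) := zetaReal_le_zetaReal_two (k := 2 * (l + 1)) (by omega)
  have hgeom : Summable fun l : ℕ => zetaReal 2 / (4 : ℝ) ^ (l + 1) := by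
    simpa [div_eq_mul_inv] using ((summable_nat_add_iff 1).2
      (summable_geometric_of_lt_one (r := (1 / 4 : ℝ)) (by norm_num) (by norm_num))).mul_left
        (zetaReal 2)
  refine hgeom.of_nonneg_of_le (fun l => ?_) fun l => ?_
  · have := hd l
    exact div_nonneg (by linarith [hz1 l]) (by positivity)
  · refine div_le_div₀ (by linarith [hz1 l, hz2 l]) (by linarith [hz2 l]) (by positivity) ?_
    exact le_mul_of_one_le_left (by positivity) (hd l)

theorem tsum_pnat_zeta_sub_one_div (d : ℕ → ℝ) :
    ∑' l : ℕ+, (riemannZeta (2 * (l : ℕ)) - 1) / ((d l : ℂ) * 4 ^ (l : ℕ)) =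
      ((∑' l : ℕ, (zetaReal (2 * (l + 1)) - 1) / (d (l + 1) * 4 ^ (l + 1)) : ℝ) : ℂ) := by
  rw [tsum_pnat_eq_tsum_succ
    (f := fun l : ℕ => (riemannZeta (2 * (l : ℕ)) - 1) / ((d l : ℂ) * 4 ^ l)), Complex.ofReal_tsum]
  refine tsum_congr fun l => ?_
  have := riemannZeta_natCast_eq_zetaReal (k := 2 * (l + 1)) (by omega)
  push_cast at this ⊢
  rw [this]

theorem SC_add_SD :
    SC + SD = ((5 / 12 * Real.log 3 - 13 / 24 * Real.log 2 - 3 / 32 +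
      zetaReal 3 / (8 * π ^ 2) : ℝ) : ℂ) := by
  have hC := tsum_pnat_zeta_sub_one_div fun l => (l : ℝ) + 1
  have hD := tsum_pnat_zeta_sub_one_div fun l => 2 * (l : ℝ) + 3
  have h := hasSum_integral_zetaReal
  simp only [integral_zetaReal_term, integral_zetaReal_sum] at h
  have hC' := (summable_zetaReal_sub_one_div (d := fun l => ((l + 1 : ℕ) : ℝ) + 1)
    fun l => by linarith [(l + 1).cast_nonneg (α := ℝ)]).hasSum.mul_left (1 / 16)
  have hD' := (summable_zetaReal_sub_one_div (d := fun l => 2 * ((l + 1 : ℕ) : ℝ) + 3)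
    fun l => by linarith [(l + 1).cast_nonneg (α := ℝ)]).hasSum.mul_left (-(1 / 24))
  rw [h.unique (hC'.add hD'), SC, SD]
  push_cast at hC hD ⊢
  rw [hC, hD]

theorem zeta_three_finite_form :
    riemannZeta 3 =
      -8 * (π : ℂ) ^ 2 *
        (((5 / 12 * Real.log 3 - 13 / 24 * Real.log 2 - 3 / 32 : ℝ) : ℂ) - SC - SD) := by
  have h3 : riemannZeta 3 = zetaReal 3 := by
    exact_mod_cast riemannZeta_natCast_eq_zetaReal (k := 3) (by norm_num)
  have hpi : (π : ℂ) ≠ 0 := by exact_mod_cast pi_ne_zero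
  rw [sub_sub, SC_add_SD, h3]
  push_cast
  field_simp
  ring
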